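/- Two-sequence fast geometric convergence (Lemma 2.3). Let (Aᵢ)_{i≥0} and (Bᵢ)_{i≥0} be sequences of positive real numbers satisfying, for all i ≥ 0, the recursive inequalities A_{i+1} ≤ C bⁱ (Aᵢ^{1+β} + Aᵢ^β Bᵢ^{1+α}) and B_{i+1} ≤ C bⁱ (Aᵢ + Bᵢ^{1+α}), where C > 1, b > 1 and α, β > 0 are given constants. Set σ = min{α, β}. If A₀ + B₀^{1+α} ≤ (2C)^{−(1+α)/σ} b^{−(1+α)/σ²}, then Aᵢ → 0 and Bᵢ → 0 as i → ∞. -/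

import Mathlib

/-- A nonnegative sequence with superlinear recursion `M (i+1) ≤ K D ^ i M i ^ (1 + σ)`, valid as
long as `M i ≤ 1`, decays geometrically once its first term is small enough. -/
theorem fast_geometric_decay {K D σ E q : ℝ} (hK : 0 < K) (hD : 0 < D) (hσ : 0 < σ)
    (hE : 0 < E) (hE1 : E ≤ 1) (hq : 0 < q) (hq1 : q ≤ 1)
    (hEK : K * E ^ σ = q) (hqD : D * q ^ σ = 1) {M : ℕ → ℝ} (hM : ∀ i, 0 < M i)
    (h0 : M 0 ≤ E) (hrec : ∀ i, M i ≤ 1 → M (i + 1) ≤ K * D ^ i * M i ^ (1 + σ)) (i : ℕ) :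
    M i ≤ E * q ^ i := by
  induction i with
  | zero => simpa using h0
  | succ i ih =>
    have hqi : 0 < q ^ i := pow_pos hq i
    have hpow : (q ^ i) ^ σ = (q ^ σ) ^ i := by
      rw [← Real.rpow_natCast, ← Real.rpow_natCast, ← Real.rpow_mul hq.le,
        ← Real.rpow_mul hq.le, mul_comm]
    have hcancel : D ^ i * (q ^ σ) ^ i = 1 := by rw [← mul_pow, hqD, one_pow]
    calc M (i + 1) ≤ K * D ^ i * M i ^ (1 + σ) :=
          hrec i (ih.trans (mul_le_one₀ hE1 hqi.le (pow_le_one₀ hq.le hq1)))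
      _ ≤ K * D ^ i * (E * q ^ i) ^ (1 + σ) := by
          have := Real.rpow_le_rpow (hM i).le ih (by linarith : 0 ≤ 1 + σ)
          gcongr
      _ = (K * E ^ σ) * (D ^ i * (q ^ σ) ^ i) * (E * q ^ i) := by
          rw [Real.rpow_add (by positivity), Real.rpow_one, Real.mul_rpow hE.le hqi.le, hpow]
          ring
      _ = E * q ^ (i + 1) := by rw [hEK, hcancel]; ring

/-- The coupled recursion for `A` and `B` gives a single superlinear recursion for
`A + B ^ (1 + α)`. -/
theorem add_rpow_le_of_coupled_le {c α β a s a' s' : ℝ} (hc : 1 ≤ c) (hα : 0 < α) (hβ : 0 < β)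
    (ha : 0 < a) (hs : 0 < s) (hs' : 0 < s')
    (hA : a' ≤ c * (a ^ (1 + β) + a ^ β * s ^ (1 + α)))
    (hB : s' ≤ c * (a + s ^ (1 + α))) (h1 : a + s ^ (1 + α) ≤ 1) :
    a' + s' ^ (1 + α) ≤ 2 * c ^ (1 + α) * (a + s ^ (1 + α)) ^ (1 + min α β) := by
  set t := s ^ (1 + α) with ht
  have htpos : 0 < t := by positivity
  have hm : 0 < a + t := by positivity
  have hcc : c ≤ c ^ (1 + α) := Real.self_le_rpow_of_one_le hc (by linarith)
  have hfst : a' ≤ c ^ (1 + α) * (a + t) ^ (1 + min α β) := by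
    calc a' ≤ c * (a ^ (1 + β) + a ^ β * t) := hA
      _ = c * (a ^ β * (a + t)) := by rw [Real.rpow_add ha, Real.rpow_one]; ring
      _ ≤ c * ((a + t) ^ β * (a + t)) := by
          have := Real.rpow_le_rpow ha.le (by linarith : a ≤ a + t) hβ.le
          gcongr
      _ = c * (a + t) ^ (1 + β) := by rw [Real.rpow_add hm, Real.rpow_one]; ring
      _ ≤ c ^ (1 + α) * (a + t) ^ (1 + min α β) := by
          have := Real.rpow_le_rpow_of_exponent_ge hm h1
            (by linarith [min_le_right α β] : 1 + min α β ≤ 1 + β)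
          gcongr
  have hsnd : s' ^ (1 + α) ≤ c ^ (1 + α) * (a + t) ^ (1 + min α β) := by
    calc s' ^ (1 + α) ≤ (c * (a + t)) ^ (1 + α) :=
          Real.rpow_le_rpow hs'.le hB (by linarith)
      _ = c ^ (1 + α) * (a + t) ^ (1 + α) := Real.mul_rpow (by linarith) hm.le
      _ ≤ c ^ (1 + α) * (a + t) ^ (1 + min α β) := by
          have := Real.rpow_le_rpow_of_exponent_ge hm h1
            (by linarith [min_le_left α β] : 1 + min α β ≤ 1 + α)
          gcongr
  linarith

/-- **Lemma 2.3: two-sequence fast geometric convergence.** -/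
theorem two_sequence_fast_geometric_convergence
    (C b α β : ℝ) (hC : 1 < C) (hb : 1 < b) (hα : 0 < α) (hβ : 0 < β)
    (A B : ℕ → ℝ) (hA : ∀ i, 0 < A i) (hB : ∀ i, 0 < B i)
    (hrecA : ∀ i : ℕ, A (i + 1) ≤ C * b ^ i * (A i ^ (1 + β) + A i ^ β * B i ^ (1 + α)))
    (hrecB : ∀ i : ℕ, B (i + 1) ≤ C * b ^ i * (A i + B i ^ (1 + α)))
    (h0 : A 0 + B 0 ^ (1 + α) ≤
      (2 * C) ^ (-(1 + α) / min α β) * b ^ (-(1 + α) / (min α β) ^ 2)) :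
    Filter.Tendsto A Filter.atTop (nhds 0) ∧ Filter.Tendsto B Filter.atTop (nhds 0) := by
  have hσ : 0 < min α β := lt_min hα hβ
  have hb0 : 0 < b := by linarith
  have hC0 : 0 < 2 * C := by linarith
  have hdecay := fast_geometric_decay (K := (2 * C) ^ (1 + α)) (D := b ^ (1 + α)) (σ := min α β)
    (E := (2 * C) ^ (-(1 + α) / min α β) * b ^ (-(1 + α) / (min α β) ^ 2))
    (q := b ^ (-(1 + α) / min α β)) (M := fun i => A i + B i ^ (1 + α))
    (by positivity) (by positivity) hσ (by positivity)
    (mul_le_one₀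
      (Real.rpow_le_one_of_one_le_of_nonpos (by linarith)
        (div_nonpos_of_nonpos_of_nonneg (by linarith) hσ.le))
      (by positivity)
      (Real.rpow_le_one_of_one_le_of_nonpos hb.le
        (div_nonpos_of_nonpos_of_nonneg (by linarith) (by positivity))))
    (by positivity)
    (Real.rpow_le_one_of_one_le_of_nonpos hb.le
      (div_nonpos_of_nonpos_of_nonneg (by linarith) hσ.le))
    (by
      rw [Real.mul_rpow (x := (2 * C) ^ _) (by positivity) (by positivity), ← Real.rpow_mul hC0.le,
        ← Real.rpow_mul hb0.le, ← mul_assoc, ← Real.rpow_add hC0,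
        div_mul_cancel₀ _ hσ.ne', add_neg_cancel, Real.rpow_zero, one_mul]
      congr 1
      field_simp)
    (by
      rw [← Real.rpow_mul hb0.le, ← Real.rpow_add hb0, div_mul_cancel₀ _ hσ.ne',
        add_neg_cancel, Real.rpow_zero])
    (fun i => add_pos (hA i) (Real.rpow_pos_of_pos (hB i) _)) h0
    (fun i hi => by
      have hbi : 1 ≤ b ^ i := one_le_pow₀ hb.le
      have hstep := add_rpow_le_of_coupled_le (by nlinarith : 1 ≤ C * b ^ i) hα hβ
        (hA i) (hB i) (hB (i + 1)) (hrecA i) (hrecB i) hi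
      have hpow : (b ^ i) ^ (1 + α) = (b ^ (1 + α)) ^ i := by
        rw [← Real.rpow_natCast, ← Real.rpow_natCast, ← Real.rpow_mul hb0.le,
          ← Real.rpow_mul hb0.le, mul_comm]
      have htwo : (2 : ℝ) ≤ 2 ^ (1 + α) :=
        Real.self_le_rpow_of_one_le (by norm_num) (by linarith)
      have hpos : 0 < A i + B i ^ (1 + α) := add_pos (hA i) (Real.rpow_pos_of_pos (hB i) _)
      refine hstep.trans ?_
      rw [Real.mul_rpow (by linarith) (by positivity), hpow,
        Real.mul_rpow (by norm_num) (by linarith), ← mul_assoc]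
      gcongr)
  have hlim : Filter.Tendsto
      (fun i : ℕ => (2 * C) ^ (-(1 + α) / min α β) * b ^ (-(1 + α) / (min α β) ^ 2) *
        (b ^ (-(1 + α) / min α β)) ^ i) Filter.atTop (nhds 0) := by
    have hq : b ^ (-(1 + α) / min α β) < 1 :=
      Real.rpow_lt_one_of_one_lt_of_neg hb (div_neg_of_neg_of_pos (by linarith) hσ)
    simpa using (tendsto_pow_atTop_nhds_zero_of_lt_one (by positivity) hq).const_mul
      ((2 * C) ^ (-(1 + α) / min α β) * b ^ (-(1 + α) / (min α β) ^ 2))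
  have hBpos : ∀ i, 0 < B i ^ (1 + α) := fun i => Real.rpow_pos_of_pos (hB i) _
  refine ⟨squeeze_zero (fun i => (hA i).le)
    (fun i => (le_add_of_nonneg_right (hBpos i).le).trans (hdecay i)) hlim, ?_⟩
  have hBlim : Filter.Tendsto (fun i => B i ^ (1 + α)) Filter.atTop (nhds 0) :=
    squeeze_zero (fun i => (hBpos i).le)
      (fun i => (le_add_of_nonneg_left (hA i).le).trans (hdecay i)) hlim
  have hroot := hBlim.rpow_const (p := (1 + α)⁻¹) (Or.inr (by positivity))
  rw [Real.zero_rpow (by positivity)] at hroot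
  exact hroot.congr fun i => Real.rpow_rpow_inv (hB i).le (by positivity)
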